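/- arXiv:2409.08995 — 3 statements merged into one kernel-verified Lean document; each statement's English description precedes it below -/
import Mathlib

section
/- Let T be a positive integer, let m, p, n be rational numbers of the form (an integer)/T, and let j₁, j₂, t be integers with 0 ≤ j₁, j₂, t ≤ T−1. Suppose that T divides m̃ − p̃ − j₂. Let r be the residue of t + p̃ − ñ − j₁ modulo T and let j₃ᵛ be the residue of −j₁ − j₂ modulo T. Then, as rational numbers, λ_t(m, r) + n − t/T = λ(n, j₃ᵛ) + m. -/
/-- `δ_i(j) = 1` if `i ≥ j` and `0` otherwise, for integers `i, j` (valued in `ℚ`). -/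
def qdelta (i j : ℤ) : ℚ := if j ≤ i then 1 else 0

/-- For a rational `x` of the form `b/T`, the residue `x̃` of `Tx = b` modulo `T`,
so that `0 ≤ x̃ < T` and `x = ⌊x⌋ + x̃/T`. -/
def til (T : ℕ) (x : ℚ) : ℤ := ⌊(T : ℚ) * x⌋ % (T : ℤ)

/-- `λ_t(x, r) = −1 + ⌊x⌋ + δ_{t+x̃}(r) + δ_{t+x̃−T}(r) + r/T`. -/
def lamt (T : ℕ) (t : ℤ) (x : ℚ) (r : ℤ) : ℚ :=
  -1 + (⌊x⌋ : ℚ) + qdelta (t + til T x) r + qdelta (t + til T x - (T : ℤ)) r + (r : ℚ) / (T : ℚ)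

/-- `λ(x, r) = −1 + ⌊x⌋ + δ_{x̃}(r) + r/T`. -/
def lam (T : ℕ) (x : ℚ) (r : ℤ) : ℚ :=
  -1 + (⌊x⌋ : ℚ) + qdelta (til T x) r + (r : ℚ) / (T : ℚ)

theorem til_intCast_div {T : ℕ} (hT : 0 < T) (a : ℤ) : til T ((a : ℚ) / (T : ℚ)) = a % (T : ℤ) := by
  have hT' : (T : ℚ) ≠ 0 := by positivity
  rw [til, mul_div_cancel₀ _ hT', Int.floor_intCast]

/-- The sum of the two step functions at a residue `r` is `⌊(s - r) / T⌋ + 1`. -/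
theorem qdelta_add_qdelta_sub {T s r : ℤ} (hs : 0 ≤ s) (hs' : s < 2 * T) (hr : 0 ≤ r)
    (hr' : r < T) : qdelta s r + qdelta (s - T) r = (((s - r) / T : ℤ) : ℚ) + 1 := by
  have hT : 0 < T := by lia
  unfold qdelta
  by_cases h₁ : r ≤ s - T
  · have : (s - r) / T = 1 := by rw [Int.ediv_eq_iff_of_pos hT]; lia
    simp [this, h₁, show r ≤ s by lia]
  · by_cases h₂ : r ≤ s
    · have : (s - r) / T = 0 := Int.ediv_eq_zero_of_lt (by lia) (by lia)
      simp [this, h₁, h₂]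
    · have : (s - r) / T = -1 := by rw [Int.ediv_eq_iff_of_pos hT]; lia
      simp [this, h₁, h₂]

theorem qdelta_eq_ediv {T s r : ℤ} (hs : 0 ≤ s) (hs' : s < T) (hr : 0 ≤ r) (hr' : r < T) :
    qdelta s r = (((s - r) / T : ℤ) : ℚ) + 1 := by
  have h : qdelta (s - T) r = 0 := by simp [qdelta]; lia
  rw [← qdelta_add_qdelta_sub hs (by lia) hr hr', h, add_zero]

/-- Lemma A.2: with `m = am/T`, `p = ap/T`, `n = an/T`, `0 ≤ j₁, j₂, t ≤ T−1`,
`T ∣ m̃ − p̃ − j₂`, `r = (t + p̃ − ñ − j₁) mod T` and `j₃ᵛ = (−j₁−j₂) mod T`, one has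
`λ_t(m, r) + n − t/T = λ(n, j₃ᵛ) + m`. -/
theorem stmt5 (T : ℕ) (hT : 0 < T) (am ap an : ℤ) (j₁ j₂ t : ℤ)
    (hj₁ : 0 ≤ j₁) (hj₁' : j₁ ≤ (T : ℤ) - 1)
    (hj₂ : 0 ≤ j₂) (hj₂' : j₂ ≤ (T : ℤ) - 1)
    (ht : 0 ≤ t) (ht' : t ≤ (T : ℤ) - 1)
    (hdvd : (T : ℤ) ∣ (am % (T : ℤ) - ap % (T : ℤ) - j₂)) :
    lamt T t ((am : ℚ) / (T : ℚ)) ((t + ap % (T : ℤ) - an % (T : ℤ) - j₁) % (T : ℤ))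
        + (an : ℚ) / (T : ℚ) - (t : ℚ) / (T : ℚ)
      = lam T ((an : ℚ) / (T : ℚ)) ((-(j₁ + j₂)) % (T : ℤ)) + (am : ℚ) / (T : ℚ) := by
  have hT0 : (0 : ℤ) < T := by exact_mod_cast hT
  have hTq : (T : ℚ) ≠ 0 := by positivity
  have hfloor (a : ℤ) : ⌊(a : ℚ) / (T : ℚ)⌋ = a / (T : ℤ) := Rat.floor_intCast_div_natCast a T
  have hsplit (a : ℤ) : ((a % (T : ℤ) : ℤ) : ℚ) + T * ((a / (T : ℤ) : ℤ) : ℚ) = a := by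
    exact_mod_cast Int.emod_add_mul_ediv a T
  have hm := hsplit am
  have hn := hsplit an
  have hM := Int.emod_nonneg am hT0.ne'
  have hM' := Int.emod_lt_of_pos am hT0
  have hN := Int.emod_nonneg an hT0.ne'
  have hN' := Int.emod_lt_of_pos an hT0
  have hr := Int.emod_nonneg (t + ap % (T : ℤ) - an % (T : ℤ) - j₁) hT0.ne'
  have hr' := Int.emod_lt_of_pos (t + ap % (T : ℤ) - an % (T : ℤ) - j₁) hT0
  have hJ := Int.emod_nonneg (-(j₁ + j₂)) hT0.ne'
  have hJ' := Int.emod_lt_of_pos (-(j₁ + j₂)) hT0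
  have hrs := Int.emod_add_mul_ediv (t + ap % (T : ℤ) - an % (T : ℤ) - j₁) T
  have hJs := Int.emod_add_mul_ediv (-(j₁ + j₂)) T
  obtain ⟨c, hc⟩ := hdvd
  unfold lamt lam
  rw [til_intCast_div hT, til_intCast_div hT, hfloor, hfloor,
    add_assoc (-1 + ((am / (T : ℤ) : ℤ) : ℚ)),
    qdelta_add_qdelta_sub (by lia) (by lia) hr hr', qdelta_eq_ediv hN hN' hJ hJ']
  generalize (t + ap % (T : ℤ) - an % (T : ℤ) - j₁) % (T : ℤ) = r at *
  generalize (-(j₁ + j₂)) % (T : ℤ) = J at *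
  generalize (t + ap % (T : ℤ) - an % (T : ℤ) - j₁) / (T : ℤ) = u at *
  generalize (-(j₁ + j₂)) / (T : ℤ) = v at *
  have key : t + am % (T : ℤ) - r = (an % (T : ℤ) - J) + T * (c + u - v) := by linarith
  have keyq : (t : ℚ) + ((am % (T : ℤ) : ℤ) : ℚ) - r =
      ((an % (T : ℤ) : ℤ) : ℚ) - J + T * (c + u - v) := by exact_mod_cast key
  rw [key, Int.add_mul_ediv_left _ _ hT0.ne']
  push_cast at hm hn keyq ⊢
  field_simp
  linarith
end

section
/- Let T be a positive integer, let m, n be rational numbers of the form (an integer)/T, and let j₃ᵛ, r, t be integers with 0 ≤ j₃ᵛ, r, t ≤ T−1. Suppose that T divides m̃ − ñ + t + j₃ᵛ − r. Then, as rational numbers, λ_t(m, r) + n − m − t/T = λ(n, j₃ᵛ). -/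
theorem floor_intCast_div (T : ℕ) (a : ℤ) : ⌊(a : ℚ) / (T : ℚ)⌋ = a / (T : ℤ) :=
  Rat.floor_intCast_div_natCast a T

/-- The difference of the `δ`-terms is the quotient by `T` of the congruent residues. -/
theorem qdelta_add_qdelta_sub_s6 {T a b j r t : ℤ} (ha : 0 ≤ a) (ha' : a < T)
    (hb : 0 ≤ b) (hb' : b < T) (hj : 0 ≤ j) (hj' : j < T) (hr : 0 ≤ r) (hr' : r < T)
    (ht : 0 ≤ t) (ht' : t < T) (hdvd : T ∣ a - b + t + j - r) :
    (T : ℚ) * (qdelta (t + a) r + qdelta (t + a - T) r - qdelta b j) =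
      a - b + t + j - r := by
  obtain ⟨k, hk⟩ := hdvd
  have hk₁ : k < 3 := by nlinarith
  have hk₂ : -2 < k := by nlinarith
  have hk' : (a : ℚ) - b + t + j - r = T * k := by exact_mod_cast hk
  rw [hk']
  unfold qdelta
  interval_cases k <;> split_ifs <;> first | omega | (push_cast; ring)

/-- Lemma A.3: with `m = am/T`, `n = an/T`, `0 ≤ j₃ᵛ, r, t ≤ T−1` and
`T ∣ m̃ − ñ + t + j₃ᵛ − r`, one has `λ_t(m, r) + n − m − t/T = λ(n, j₃ᵛ)`. -/
theorem stmt6 (T : ℕ) (hT : 0 < T) (am an : ℤ) (j₃ r t : ℤ)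
    (hj₃ : 0 ≤ j₃) (hj₃' : j₃ ≤ (T : ℤ) - 1)
    (hr : 0 ≤ r) (hr' : r ≤ (T : ℤ) - 1)
    (ht : 0 ≤ t) (ht' : t ≤ (T : ℤ) - 1)
    (hdvd : (T : ℤ) ∣ (am % (T : ℤ) - an % (T : ℤ) + t + j₃ - r)) :
    lamt T t ((am : ℚ) / (T : ℚ)) r + (an : ℚ) / (T : ℚ) - (am : ℚ) / (T : ℚ)
        - (t : ℚ) / (T : ℚ)
      = lam T ((an : ℚ) / (T : ℚ)) j₃ := by
  have hT' : (T : ℚ) ≠ 0 := by positivity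
  have hTpos : (0 : ℤ) < T := by exact_mod_cast hT
  have key := qdelta_add_qdelta_sub_s6 (Int.emod_nonneg am hTpos.ne') (Int.emod_lt_of_pos am hTpos)
    (Int.emod_nonneg an hTpos.ne') (Int.emod_lt_of_pos an hTpos)
    hj₃ (by omega) hr (by omega) ht (by omega) hdvd
  have hm : (am : ℚ) = (am % (T : ℤ) : ℤ) + (T : ℚ) * (am / (T : ℤ) : ℤ) := by
    exact_mod_cast (Int.emod_add_mul_ediv am T).symm
  have hn : (an : ℚ) = (an % (T : ℤ) : ℤ) + (T : ℚ) * (an / (T : ℤ) : ℤ) := by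
    exact_mod_cast (Int.emod_add_mul_ediv an T).symm
  rw [lamt, lam, til_intCast_div hT, til_intCast_div hT, floor_intCast_div, floor_intCast_div]
  rw [Int.cast_natCast] at key
  field_simp
  linear_combination key + hn - hm
end

section
/- Let e, f be natural numbers. Then in the field of rational functions ℚ(z) one has the identity ∑_{i=0}^{e} (−1)^i · binom(f+i, i) · z^{−f−i} − (−1)^e · ∑_{i=0}^{f} binom(e+i, i) · (1+z)^{i−f−1} · z^{−e−i} = z · (1+z)^{−f−1}, where binom denotes the ordinary binomial coefficient of natural numbers. -/
/-- Telescoping recursion for the truncations of the power series of `(1 - x) ^ (-(f + 1))`. -/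
theorem one_sub_mul_sum_choose {R : Type*} [CommRing R] (x : R) (e f : ℕ) :
    (1 - x) * ∑ i ∈ Finset.range (e + 1), (Nat.choose (f + 1 + i) i : R) * x ^ i
      = ∑ i ∈ Finset.range (e + 1), (Nat.choose (f + i) i : R) * x ^ i
        - (Nat.choose (f + 1 + e) e : R) * x ^ (e + 1) := by
  induction e with
  | zero => simp
  | succ e ih =>
    rw [Finset.sum_range_succ, mul_add, ih,
      Finset.sum_range_succ (fun i => (Nat.choose (f + i) i : R) * x ^ i) (e + 1)]
    have h : (Nat.choose (f + 1 + (e + 1)) (e + 1) : R)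
        = Nat.choose (f + 1 + e) e + Nat.choose (f + (e + 1)) (e + 1) := by
      rw [← add_assoc (f + 1) e 1, Nat.choose_succ_succ, add_right_comm f 1 e, add_assoc f e 1]
      push_cast
      rfl
    rw [h]
    ring

/-- The Bézout identity between `(1 - x) ^ (f + 1)` and `x ^ (e + 1)`. -/
theorem bezout_one_sub_pow_pow {R : Type*} [CommRing R] (x : R) (e f : ℕ) :
    (1 - x) ^ (f + 1) * ∑ i ∈ Finset.range (e + 1), (Nat.choose (f + i) i : R) * x ^ i
      + x ^ (e + 1) * ∑ i ∈ Finset.range (f + 1), (Nat.choose (e + i) i : R) * (1 - x) ^ i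
      = 1 := by
  induction f with
  | zero =>
    have h := mul_neg_geom_sum x (e + 1)
    simp [h]
  | succ f ih =>
    rw [pow_succ, mul_assoc, one_sub_mul_sum_choose, Finset.sum_range_succ _ (f + 1)]
    have h : Nat.choose (f + 1 + e) e = Nat.choose (e + (f + 1)) (f + 1) := by
      rw [add_comm, Nat.choose_symm_add]
    rw [h]
    linear_combination ih

/-- The rational-function identity used in the proof of Proposition 5.3:
`∑_{i=0}^{e} (−1)^i binom(f+i, i) z^{−f−i}
  − (−1)^e ∑_{i=0}^{f} binom(e+i, i) (1+z)^{i−f−1} z^{−e−i} = z (1+z)^{−f−1}`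
in the field `ℚ(z)` of rational functions. -/
theorem stmt10 (e f : ℕ) :
    (∑ i ∈ Finset.range (e + 1),
        (-1 : RatFunc ℚ) ^ i * (Nat.choose (f + i) i : RatFunc ℚ)
          * RatFunc.X ^ (-(f : ℤ) - (i : ℤ)))
      - (-1 : RatFunc ℚ) ^ e *
        (∑ i ∈ Finset.range (f + 1),
          (Nat.choose (e + i) i : RatFunc ℚ)
            * (1 + RatFunc.X) ^ ((i : ℤ) - (f : ℤ) - 1)
            * RatFunc.X ^ (-(e : ℤ) - (i : ℤ)))
    = RatFunc.X * (1 + RatFunc.X) ^ (-(f : ℤ) - 1) := by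
  have hX : (RatFunc.X : RatFunc ℚ) ≠ 0 := RatFunc.X_ne_zero
  have hY : (1 + RatFunc.X : RatFunc ℚ) ≠ 0 := by
    have h : (1 + RatFunc.X : RatFunc ℚ)
        = algebraMap (Polynomial ℚ) (RatFunc ℚ) (Polynomial.X + Polynomial.C 1) := by
      simp [add_comm]
    rw [h]
    exact RatFunc.algebraMap_ne_zero (Polynomial.X_add_C_ne_zero 1)
  generalize (RatFunc.X : RatFunc ℚ) = z at hX hY ⊢
  have key := bezout_one_sub_pow_pow (-z⁻¹) e f
  have hx : 1 - -z⁻¹ = (1 + z) * z⁻¹ := by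
    field_simp
    ring
  rw [hx] at key
  have h₁ : ∑ i ∈ Finset.range (e + 1),
        (-1 : RatFunc ℚ) ^ i * (Nat.choose (f + i) i : RatFunc ℚ) * z ^ (-(f : ℤ) - (i : ℤ))
      = z⁻¹ ^ f * ∑ i ∈ Finset.range (e + 1), (Nat.choose (f + i) i : RatFunc ℚ) * (-z⁻¹) ^ i := by
    rw [Finset.mul_sum]
    refine Finset.sum_congr rfl fun i _ => ?_
    rw [zpow_sub₀ hX, zpow_neg, zpow_natCast, zpow_natCast, neg_pow z⁻¹, inv_pow, inv_pow]
    ring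
  have h₂ : ∑ i ∈ Finset.range (f + 1),
        (Nat.choose (e + i) i : RatFunc ℚ) * (1 + z) ^ ((i : ℤ) - (f : ℤ) - 1)
          * z ^ (-(e : ℤ) - (i : ℤ))
      = (1 + z)⁻¹ ^ (f + 1) * z⁻¹ ^ e * ∑ i ∈ Finset.range (f + 1),
        (Nat.choose (e + i) i : RatFunc ℚ) * ((1 + z) * z⁻¹) ^ i := by
    rw [Finset.mul_sum]
    refine Finset.sum_congr rfl fun i _ => ?_
    rw [zpow_sub₀ hX, zpow_sub₀ hY, zpow_sub₀ hY, zpow_neg, zpow_one]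
    simp only [zpow_natCast, inv_pow, mul_pow, pow_succ (1 + z), mul_inv]
    ring
  have h₃ : (1 + z) ^ (-(f : ℤ) - 1) = (1 + z)⁻¹ ^ (f + 1) := by
    rw [zpow_sub₀ hY, zpow_neg, zpow_one, zpow_natCast, inv_pow, pow_succ, mul_inv, div_eq_mul_inv]
  rw [h₁, h₂, h₃]
  generalize ∑ i ∈ Finset.range (e + 1),
    (Nat.choose (f + i) i : RatFunc ℚ) * (-z⁻¹) ^ i = S at key ⊢
  generalize ∑ i ∈ Finset.range (f + 1),
    (Nat.choose (e + i) i : RatFunc ℚ) * ((1 + z) * z⁻¹) ^ i = T at key ⊢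
  have hz : z * z⁻¹ = 1 := mul_inv_cancel₀ hX
  have hy : (1 + z) ^ (f + 1) * (1 + z)⁻¹ ^ (f + 1) = 1 := by
    rw [← mul_pow, mul_inv_cancel₀ hY, one_pow]
  rw [neg_pow, mul_pow, pow_succ z⁻¹, pow_succ z⁻¹, pow_succ (-1 : RatFunc ℚ)] at key
  generalize (1 + z) ^ (f + 1) = a at key hy ⊢
  generalize (1 + z)⁻¹ ^ (f + 1) = b at hy ⊢
  generalize (-1 : RatFunc ℚ) ^ e = s at key ⊢
  linear_combination z * b * key - z⁻¹ ^ f * S * z * z⁻¹ * hy - z⁻¹ ^ f * S * hz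
    + s * b * z⁻¹ ^ e * T * hz
end
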